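/- Suppose the DFP initialization satisfies ‖x_0 − x_*‖ ≤ min{ μ^{3/2}ε/(M√L), μδ/(M√d) } and B_0 = ∇²f(x_0), where ε, δ > 0 are such that for some r ∈ (0, 1) both [4(2δ + 1)/(1 − ε)² + (3 + ε)/(1 − ε)]·ε/(1 − r) ≤ δ and ε + 2δ ≤ r/(1 + r). Then for every k ≥ 1 the DFP iterates satisfy ‖x_k − x_*‖ ≤ √(L/μ)·( (2√2·δ·((1 + r)/(1 − ε))·√k + (1 + r)ε/((1 − r)(1 − ε))) / k )^k · ‖x_0 − x_*‖. -/

import Mathlib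

noncomputable section

open Matrix Finset

abbrev E (d : ℕ) := EuclideanSpace ℝ (Fin d)
abbrev Mat (d : ℕ) := Matrix (Fin d) (Fin d) ℝ

/-- Spectral (operator 2-) norm of a real matrix. -/
def spec {d : ℕ} (A : Mat d) : ℝ := ‖Matrix.toEuclideanCLM (𝕜 := ℝ) A‖

/-- Frobenius norm of a real matrix. -/
def frob {d : ℕ} (A : Mat d) : ℝ := Real.sqrt (∑ i, ∑ j, (A i j) ^ 2)

/-- A matrix acting on a Euclidean vector. -/
def mApp {d : ℕ} (A : Mat d) (v : E d) : E d := Matrix.toEuclideanCLM (𝕜 := ℝ) A v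

/-- Outer product `u vᵀ`. -/
def outer {d : ℕ} (u v : E d) : Mat d := Matrix.of fun i j => u i * v j

/-- Euclidean dot product. -/
def dot {d : ℕ} (u v : E d) : ℝ := ∑ i, u i * v i

/-- `σ(x) = (M/μ^{3/2})·‖H_*^{1/2}(x − x_*)‖`. -/
def sig {d : ℕ} (M μ : ℝ) (sqH : Mat d) (xs x : E d) : ℝ :=
  M / μ ^ ((3:ℝ)/2) * ‖mApp sqH (x - xs)‖

/-- The DFP update of the Hessian approximation. -/
def dfpUpdate {d : ℕ} (B : Mat d) (s y : E d) : Mat d :=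
  (1 - (dot y s)⁻¹ • outer y s) * B * (1 - (dot s y)⁻¹ • outer s y)
    + (dot y s)⁻¹ • outer y y

lemma mApp_apply {d : ℕ} (A : Mat d) (v : E d) (i : Fin d) :
    mApp A v i = ∑ j, A i j * v j := rfl

lemma mApp_mul {d : ℕ} (A B : Mat d) (v : E d) : mApp (A * B) v = mApp A (mApp B v) := by
  simp [mApp, map_mul]

lemma mApp_one {d : ℕ} (v : E d) : mApp (1 : Mat d) v = v := by
  simp [mApp, map_one]

lemma mApp_sub_left {d : ℕ} (A B : Mat d) (v : E d) :
    mApp (A - B) v = mApp A v - mApp B v := by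
  simp [mApp, map_sub]

lemma mApp_sub {d : ℕ} (A : Mat d) (u v : E d) : mApp A (u - v) = mApp A u - mApp A v := by
  simp [mApp, map_sub]

lemma mApp_smul {d : ℕ} (A : Mat d) (c : ℝ) (v : E d) : mApp A (c • v) = c • mApp A v := by
  simp [mApp]

lemma norm_mApp_le_spec {d : ℕ} (A : Mat d) (v : E d) : ‖mApp A v‖ ≤ spec A * ‖v‖ :=
  ContinuousLinearMap.le_opNorm _ _

lemma dot_eq_inner {d : ℕ} (u v : E d) : dot u v = inner ℝ u v := by
  simp [dot, PiLp.inner_apply, mul_comm]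

lemma dot_comm {d : ℕ} (u v : E d) : dot u v = dot v u := by
  simp [dot, mul_comm]

lemma dot_self {d : ℕ} (u : E d) : dot u u = ‖u‖ ^ 2 := by
  rw [dot_eq_inner, real_inner_self_eq_norm_sq]

lemma abs_dot_le {d : ℕ} (u v : E d) : |dot u v| ≤ ‖u‖ * ‖v‖ := by
  rw [dot_eq_inner]; exact abs_real_inner_le_norm u v

lemma dot_mApp {d : ℕ} (A : Mat d) (u v : E d) : dot u (mApp A v) = dot (mApp Aᵀ u) v := by
  simp only [dot, mApp_apply, Finset.mul_sum, Finset.sum_mul, Matrix.transpose_apply]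
  rw [Finset.sum_comm]
  exact Finset.sum_congr rfl fun i _ => Finset.sum_congr rfl fun j _ => by ring

lemma transpose_outer {d : ℕ} (u v : E d) : (outer u v)ᵀ = outer v u := by
  ext i j; simp [outer, mul_comm]

lemma mul_outer {d : ℕ} (A : Mat d) (u v : E d) : A * outer u v = outer (mApp A u) v := by
  ext i j
  simp [Matrix.mul_apply, outer, mApp_apply, Finset.sum_mul, mul_assoc]

lemma outer_mul {d : ℕ} (A : Mat d) (u v : E d) : outer u v * A = outer u (mApp Aᵀ v) := by
  rw [← Matrix.transpose_transpose (outer u v * A), Matrix.transpose_mul, transpose_outer,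
    mul_outer, transpose_outer]

lemma mApp_outer {d : ℕ} (u v w : E d) : mApp (outer u v) w = dot v w • u := by
  ext i
  simp only [mApp_apply, outer, Matrix.of_apply, PiLp.smul_apply, smul_eq_mul, dot,
    Finset.sum_mul]
  exact Finset.sum_congr rfl fun j _ => by ring

lemma frob_eq_norm {d : ℕ} (A : Mat d) :
    frob A = ‖(WithLp.toLp 2 fun p : Fin d × Fin d => A p.1 p.2 :
      EuclideanSpace ℝ (Fin d × Fin d))‖ := by
  simp [frob, EuclideanSpace.norm_eq, Fintype.sum_prod_type]

lemma frob_nonneg {d : ℕ} (A : Mat d) : 0 ≤ frob A := Real.sqrt_nonneg _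

lemma frob_sq {d : ℕ} (A : Mat d) : frob A ^ 2 = ∑ i, ∑ j, (A i j) ^ 2 :=
  Real.sq_sqrt (by positivity)

lemma frob_add_le {d : ℕ} (A B : Mat d) : frob (A + B) ≤ frob A + frob B := by
  simp only [frob_eq_norm]
  exact norm_add_le (WithLp.toLp 2 fun p : Fin d × Fin d => A p.1 p.2 :
      EuclideanSpace ℝ (Fin d × Fin d)) (WithLp.toLp 2 fun p : Fin d × Fin d => B p.1 p.2)

lemma frob_smul {d : ℕ} (c : ℝ) (A : Mat d) : frob (c • A) = |c| * frob A := by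
  simp only [frob_eq_norm]
  exact norm_smul c (WithLp.toLp 2 fun p : Fin d × Fin d => A p.1 p.2 :
      EuclideanSpace ℝ (Fin d × Fin d))

lemma frob_transpose {d : ℕ} (A : Mat d) : frob Aᵀ = frob A := by
  unfold frob
  rw [Finset.sum_comm]
  rfl

lemma frob_outer {d : ℕ} (u v : E d) : frob (outer u v) = ‖u‖ * ‖v‖ := by
  rw [← sq_eq_sq₀ (frob_nonneg _) (by positivity), frob_sq, mul_pow, ← dot_self, ← dot_self]
  simp only [dot, outer, Matrix.of_apply, Finset.sum_mul_sum]
  exact Finset.sum_congr rfl fun i _ => Finset.sum_congr rfl fun j _ => by ring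

lemma norm_mApp_le_frob {d : ℕ} (A : Mat d) (v : E d) : ‖mApp A v‖ ≤ frob A * ‖v‖ := by
  rw [← sq_le_sq₀ (norm_nonneg _) (mul_nonneg (frob_nonneg _) (norm_nonneg _)), mul_pow, frob_sq,
    ← dot_self, ← dot_self, Finset.sum_mul]
  simp only [dot, mApp_apply]
  refine Finset.sum_le_sum fun i _ => ?_
  have := Finset.sum_mul_sq_le_sq_mul_sq Finset.univ (fun j => A i j) (fun j => v j)
  simpa [sq] using this

lemma frob_le_sqrt_mul_spec {d : ℕ} (A : Mat d) : frob A ≤ Real.sqrt d * spec A := by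
  have hspec : 0 ≤ spec A := norm_nonneg _
  rw [← sq_le_sq₀ (frob_nonneg _) (by positivity), mul_pow, Real.sq_sqrt (by positivity), frob_sq,
    Finset.sum_comm]
  have hcol : ∀ j : Fin d, ∑ i, (A i j) ^ 2 ≤ spec A ^ 2 := fun j => by
    have h := norm_mApp_le_spec A (EuclideanSpace.single j 1)
    rw [PiLp.norm_single, norm_one, mul_one,
      ← sq_le_sq₀ (norm_nonneg _) hspec, ← dot_self] at h
    simpa [dot, mApp_apply, sq] using h
  calc _ ≤ ∑ _j : Fin d, spec A ^ 2 := Finset.sum_le_sum fun j _ => hcol j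
    _ = _ := by simp

lemma frob_mul_one_sub_outer_sq {d : ℕ} (A : Mat d) {s : E d} (hs : ‖s‖ = 1) :
    frob (A * (1 - outer s s)) ^ 2 = frob A ^ 2 - ‖mApp A s‖ ^ 2 := by
  have hss : ∑ j, s j ^ 2 = 1 := by
    have := dot_self s
    rw [hs] at this
    simpa [dot, sq] using this
  rw [mul_sub, mul_one, mul_outer, frob_sq, frob_sq, ← dot_self, dot, ← Finset.sum_sub_distrib]
  refine Finset.sum_congr rfl fun i _ => ?_
  have h : ∀ j, ((A - outer (mApp A s) s) i j) ^ 2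
      = A i j ^ 2 - 2 * mApp A s i * (A i j * s j) + mApp A s i ^ 2 * s j ^ 2 := fun j => by
    simp only [Matrix.sub_apply, outer, Matrix.of_apply]; ring
  simp only [h, Finset.sum_add_distrib, Finset.sum_sub_distrib, ← Finset.mul_sum, hss,
    ← mApp_apply]
  ring

lemma frob_mul_one_sub_outer_le {d : ℕ} (A : Mat d) {s : E d} (hs : ‖s‖ = 1) :
    frob (A * (1 - outer s s)) ≤ frob A := by
  rw [← sq_le_sq₀ (frob_nonneg _) (frob_nonneg _), frob_mul_one_sub_outer_sq A hs]
  nlinarith [sq_nonneg ‖mApp A s‖]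

lemma frob_one_sub_outer_mul_le {d : ℕ} (A : Mat d) {s : E d} (hs : ‖s‖ = 1) :
    frob ((1 - outer s s) * A) ≤ frob A := by
  have h := frob_mul_one_sub_outer_le Aᵀ hs
  rwa [← frob_transpose, Matrix.transpose_mul, Matrix.transpose_transpose, frob_transpose,
    Matrix.transpose_sub, transpose_outer, Matrix.transpose_one] at h

lemma norm_mApp_le_one_add_frob {d : ℕ} (B : Mat d) (v : E d) :
    ‖mApp B v‖ ≤ (1 + frob (B - 1)) * ‖v‖ := by
  have h : mApp B v = v + mApp (B - 1) v := by rw [mApp_sub_left, mApp_one]; abel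
  rw [h]
  linarith [norm_add_le v (mApp (B - 1) v), norm_mApp_le_frob (B - 1) v]

lemma dfpUpdate_smul {d : ℕ} (B : Mat d) (s y : E d) {c : ℝ} (hc : c ≠ 0) :
    dfpUpdate B (c • s) (c • y) = dfpUpdate B s y := by
  have hd : ∀ u v : E d, dot (c • u) (c • v) = c ^ 2 * dot u v := fun u v => by
    simp only [dot, Finset.mul_sum, PiLp.smul_apply, smul_eq_mul]
    exact Finset.sum_congr rfl fun i _ => by ring
  have ho : ∀ u v : E d, outer (c • u) (c • v) = c ^ 2 • outer u v := fun u v => by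
    ext i j; simp [outer]; ring
  have hcc : ∀ t : ℝ, (c ^ 2 * t)⁻¹ * c ^ 2 = t⁻¹ := fun t => by
    rw [mul_inv]; field_simp
  simp only [dfpUpdate, hd, ho, smul_smul, hcc]

/-- One DFP step contracts the Frobenius distance to the identity, up to a perturbation that is
linear in the relative distance of `y` to `s`. -/
lemma frob_dfpUpdate_sub_one_le_of_norm_eq_one {d : ℕ} (B : Mat d) {s y : E d} {τ : ℝ}
    (hs : ‖s‖ = 1) (hy : ‖y - s‖ ≤ τ) (hτ : τ < 1) :
    frob (dfpUpdate B s y - 1) ≤ Real.sqrt (frob (B - 1) ^ 2 - ‖mApp (B - 1) s‖ ^ 2)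
      + τ * (4 * (frob (B - 1) + 1) / (1 - τ) ^ 2 + (3 + τ) / (1 - τ)) := by
  have hτ0 : 0 ≤ τ := (norm_nonneg _).trans hy
  obtain ⟨e, rfl⟩ : ∃ e, y = s + e := ⟨y - s, by abel⟩
  have he : ‖e‖ ≤ τ := by simpa using hy
  set N := frob (B - 1) with hN
  have hN0 : 0 ≤ N := frob_nonneg _
  have hes : |dot e s| ≤ τ := by
    have := abs_dot_le e s
    rw [hs, mul_one] at this
    exact this.trans he
  set η := dot (s + e) s with hη
  have hηe : η = 1 + dot e s := by
    rw [hη, dot_eq_inner, inner_add_left, ← dot_eq_inner, ← dot_eq_inner, dot_self, hs]; norm_num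
  have hη1 : 1 - τ ≤ η := by linarith [neg_le_of_abs_le hes]
  have hη0 : 0 < η := by linarith
  have hηinv : |η⁻¹| ≤ 1 / (1 - τ) := by
    rw [abs_of_pos (inv_pos.2 hη0), ← one_div]
    exact one_div_le_one_div_of_le (by linarith) hη1
  set w := s - η⁻¹ • (s + e) with hw
  have hwn : ‖w‖ ≤ 2 * τ / (1 - τ) := by
    have : w = η⁻¹ • (dot e s • s - e) := by
      rw [hw]
      have : s = η⁻¹ • (η • s) := by rw [smul_smul, inv_mul_cancel₀ hη0.ne', one_smul]
      nth_rewrite 1 [this]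
      rw [hηe]; module
    rw [this, norm_smul, Real.norm_eq_abs]
    have h2 : ‖dot e s • s - e‖ ≤ 2 * τ := by
      have := norm_sub_le (dot e s • s) e
      rw [norm_smul, hs, mul_one, Real.norm_eq_abs] at this
      linarith
    calc |η⁻¹| * ‖dot e s • s - e‖ ≤ 1 / (1 - τ) * (2 * τ) := by gcongr
      _ = _ := by ring
  set P : Mat d := 1 - outer s s with hP
  have hss : outer s s * outer s s = outer s s := by
    rw [mul_outer, mApp_outer, dot_self, hs]; norm_num
  have hPP : P * P = P := by
    rw [hP, sub_mul, mul_sub, mul_sub, hss]; simp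
  have hQ : 1 - η⁻¹ • outer (s + e) s = P + outer w s := by
    rw [hP, hw]; ext i j; simp [outer]; ring
  have hQ' : 1 - η⁻¹ • outer s (s + e) = P + outer s w := by
    rw [hP, hw]; ext i j; simp [outer]; ring
  set T : Mat d := η⁻¹ • (outer s e + outer e s + outer e e + (-dot e s) • outer s s) with hT
  have hTy : η⁻¹ • outer (s + e) (s + e) = T + outer s s := by
    have : outer s s = η⁻¹ • (η • outer s s) := by
      rw [smul_smul, inv_mul_cancel₀ hη0.ne', one_smul]
    nth_rewrite 1 [this]
    rw [hT, ← smul_add, hηe]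
    congr 1
    ext i j; simp [outer]; ring
  have hdec : dfpUpdate B s (s + e) - 1 = P * ((B - 1) * P) + outer w s * B * P
      + P * (B * outer s w) + outer w s * (B * outer s w) + T := by
    unfold dfpUpdate
    rw [dot_comm s (s + e), ← hη, hQ, hQ', hTy]
    have h1 : outer s s = 1 - P := by rw [hP]; abel
    have h2 : P * ((B - 1) * P) = P * B * P - P := by
      rw [sub_mul B 1 P, one_mul, mul_sub P (B * P) P, hPP, mul_assoc]
    rw [h1, h2]
    noncomm_ring
  have hBs : ‖mApp B s‖ ≤ N + 1 := by
    have := norm_mApp_le_one_add_frob B s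
    rw [hs] at this; linarith
  have hBts : ‖mApp Bᵀ s‖ ≤ N + 1 := by
    have := norm_mApp_le_one_add_frob Bᵀ s
    rw [hs, ← Matrix.transpose_one, ← Matrix.transpose_sub, frob_transpose] at this; linarith
  have hw0 := norm_nonneg w
  have b1 : frob (P * ((B - 1) * P)) ≤ Real.sqrt (N ^ 2 - ‖mApp (B - 1) s‖ ^ 2) := by
    refine (frob_one_sub_outer_mul_le _ hs).trans ?_
    rw [hN, ← frob_mul_one_sub_outer_sq _ hs, Real.sqrt_sq (frob_nonneg _)]
  have b2 : frob (outer w s * B * P) ≤ ‖w‖ * (N + 1) := by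
    refine (frob_mul_one_sub_outer_le _ hs).trans ?_
    rw [outer_mul, frob_outer]; gcongr
  have b3 : frob (P * (B * outer s w)) ≤ ‖w‖ * (N + 1) := by
    refine (frob_one_sub_outer_mul_le _ hs).trans ?_
    rw [mul_outer, frob_outer, mul_comm]; gcongr
  have b4 : frob (outer w s * (B * outer s w)) ≤ ‖w‖ * ‖w‖ * (N + 1) := by
    rw [mul_outer, mul_outer, mApp_outer, frob_outer, norm_smul, Real.norm_eq_abs]
    have : |dot s (mApp B s)| ≤ N + 1 := by
      have := abs_dot_le s (mApp B s)
      rw [hs, one_mul] at this; exact this.trans hBs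
    nlinarith [mul_nonneg hw0 hw0]
  have b5 : frob T ≤ τ * ((3 + τ) / (1 - τ)) := by
    have h : frob (outer s e + outer e s + outer e e + (-dot e s) • outer s s) ≤ τ * (3 + τ) := by
      have h1 := frob_add_le (outer s e + outer e s + outer e e) ((-dot e s) • outer s s)
      have h2 := frob_add_le (outer s e + outer e s) (outer e e)
      have h3 := frob_add_le (outer s e) (outer e s)
      rw [frob_smul, abs_neg, frob_outer, hs] at h1
      rw [frob_outer] at h2
      rw [frob_outer, frob_outer, hs] at h3
      have : ‖e‖ * ‖e‖ ≤ τ * τ := by gcongr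
      linarith
    rw [hT, frob_smul]
    calc _ ≤ 1 / (1 - τ) * (τ * (3 + τ)) := mul_le_mul hηinv h (frob_nonneg _)
          (one_div_nonneg.2 (by linarith))
      _ = _ := by ring
  have b6 : ‖w‖ * (N + 1) + ‖w‖ * (N + 1) + ‖w‖ * ‖w‖ * (N + 1)
      ≤ τ * (4 * (N + 1) / (1 - τ) ^ 2) := by
    set t := 2 * τ / (1 - τ) with ht
    have ht0 : 0 ≤ t := hw0.trans hwn
    calc ‖w‖ * (N + 1) + ‖w‖ * (N + 1) + ‖w‖ * ‖w‖ * (N + 1)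
        ≤ t * (N + 1) + t * (N + 1) + t * t * (N + 1) := by gcongr
      _ = _ := by
        have : 1 - τ ≠ 0 := by linarith
        rw [ht]; field_simp; ring
  rw [hdec, mul_add]
  have a1 := frob_add_le (P * ((B - 1) * P) + outer w s * B * P
      + P * (B * outer s w) + outer w s * (B * outer s w)) T
  have a2 := frob_add_le (P * ((B - 1) * P) + outer w s * B * P
      + P * (B * outer s w)) (outer w s * (B * outer s w))
  have a3 := frob_add_le (P * ((B - 1) * P) + outer w s * B * P) (P * (B * outer s w))
  have a4 := frob_add_le (P * ((B - 1) * P)) (outer w s * B * P)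
  linarith

lemma sqrt_sq_sub_le {a b c : ℝ} (ha : 0 ≤ a) (hb : 0 ≤ b) (hba : b ≤ a) (hac : a ≤ c)
    (hc : 0 < c) : Real.sqrt (a ^ 2 - b ^ 2) ≤ a - b ^ 2 / (2 * c) := by
  have hb2 : b ^ 2 ≤ a * c := by nlinarith
  have h1 : b ^ 2 / (2 * c) ≤ a / 2 := by
    rw [div_le_iff₀ (by positivity)]; nlinarith
  rw [Real.sqrt_le_iff]
  refine ⟨by linarith, ?_⟩
  have h2 : b ^ 2 = 2 * c * (b ^ 2 / (2 * c)) := by field_simp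
  have h3 : 0 ≤ b ^ 2 / (2 * c) := by positivity
  generalize b ^ 2 / (2 * c) = q at *
  rw [h2]
  nlinarith [mul_nonneg h3 (sub_nonneg.2 hac)]

lemma frob_dfpUpdate_sub_one_le {d : ℕ} (B : Mat d) {s y : E d} {τ c : ℝ}
    (hs : s ≠ 0) (hy : ‖y - s‖ ≤ τ * ‖s‖) (hτ : τ < 1) (hc : 0 < c) (hB : frob (B - 1) ≤ c) :
    frob (dfpUpdate B s y - 1) ≤ frob (B - 1) - (‖mApp (B - 1) s‖ / ‖s‖) ^ 2 / (2 * c)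
      + τ * (4 * (c + 1) / (1 - τ) ^ 2 + (3 + τ) / (1 - τ)) := by
  have hs0 : 0 < ‖s‖ := norm_pos_iff.2 hs
  have hn : ‖‖s‖⁻¹ • s‖ = 1 := by rw [norm_smul, norm_inv, norm_norm, inv_mul_cancel₀ hs0.ne']
  have hy' : ‖‖s‖⁻¹ • y - ‖s‖⁻¹ • s‖ ≤ τ := by
    rw [← smul_sub, norm_smul, norm_inv, norm_norm, inv_mul_le_iff₀ hs0, mul_comm]; exact hy
  have hτ0 : 0 ≤ τ := (norm_nonneg _).trans hy'
  have h := frob_dfpUpdate_sub_one_le_of_norm_eq_one B hn hy' hτ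
  rw [dfpUpdate_smul B s y (inv_ne_zero hs0.ne')] at h
  have hq : ‖mApp (B - 1) (‖s‖⁻¹ • s)‖ = ‖mApp (B - 1) s‖ / ‖s‖ := by
    rw [mApp_smul, norm_smul, norm_inv, norm_norm, div_eq_inv_mul]
  rw [hq] at h
  have hq1 : ‖mApp (B - 1) s‖ / ‖s‖ ≤ frob (B - 1) := by
    rw [div_le_iff₀ hs0]; exact norm_mApp_le_frob _ _
  have h2 := sqrt_sq_sub_le (frob_nonneg (B - 1)) (by positivity) hq1 hB hc
  have h3 : τ * (4 * (frob (B - 1) + 1) / (1 - τ) ^ 2 + (3 + τ) / (1 - τ))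
      ≤ τ * (4 * (c + 1) / (1 - τ) ^ 2 + (3 + τ) / (1 - τ)) := by gcongr
  linarith

lemma one_sub_mul_norm_le {d : ℕ} {B : Mat d} {a : ℝ} (hB : frob (B - 1) ≤ a) (v : E d) :
    (1 - a) * ‖v‖ ≤ ‖mApp B v‖ := by
  have h : v = mApp B v - mApp (B - 1) v := by rw [mApp_sub_left, mApp_one]; abel
  have h1 := norm_sub_le (mApp B v) (mApp (B - 1) v)
  rw [← h] at h1
  have h2 := norm_mApp_le_frob (B - 1) v
  nlinarith [mul_le_mul_of_nonneg_right hB (norm_nonneg v)]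

lemma isUnit_det_of_frob_sub_one_lt {d : ℕ} {B : Mat d} (hB : frob (B - 1) < 1) :
    IsUnit B.det := by
  rw [isUnit_iff_ne_zero]
  intro h0
  obtain ⟨v, hv, hBv⟩ := Matrix.exists_mulVec_eq_zero_iff.2 h0
  have h := one_sub_mul_norm_le (B := B) le_rfl (WithLp.toLp 2 v)
  have hz : mApp B (WithLp.toLp 2 v) = 0 := by
    ext i
    exact congrFun hBv i
  rw [hz, norm_zero] at h
  have hv0 : 0 < ‖(WithLp.toLp 2 v : E d)‖ := norm_pos_iff.2 (by simpa using hv)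
  nlinarith

lemma mApp_mApp_inv {d : ℕ} {B : Mat d} (hB : IsUnit B.det) (v : E d) :
    mApp B (mApp B⁻¹ v) = v := by
  rw [← mApp_mul, Matrix.mul_nonsing_inv _ hB, mApp_one]

lemma mApp_inv_mApp {d : ℕ} {B : Mat d} (hB : IsUnit B.det) (v : E d) :
    mApp B⁻¹ (mApp B v) = v := by
  rw [← mApp_mul, Matrix.nonsing_inv_mul _ hB, mApp_one]

lemma norm_quasiNewton_step_le {d : ℕ} {B : Mat d} {a σ : ℝ} (hB : frob (B - 1) ≤ a)
    (ha : a < 1) {u p : E d} (hp : ‖p - u‖ ≤ σ * ‖u‖) :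
    (1 - a) * ‖u - mApp B⁻¹ p‖ ≤ (a + σ) * ‖u‖ := by
  refine (one_sub_mul_norm_le hB _).trans ?_
  have h : mApp B (u - mApp B⁻¹ p) = mApp (B - 1) u - (p - u) := by
    rw [mApp_sub, mApp_mApp_inv (isUnit_det_of_frob_sub_one_lt (hB.trans_lt ha)), mApp_sub_left,
      mApp_one]
    abel
  rw [h]
  have h1 := norm_sub_le (mApp (B - 1) u) (p - u)
  have h2 := norm_mApp_le_frob (B - 1) u
  have h3 := mul_le_mul_of_nonneg_right hB (norm_nonneg u)
  linarith

lemma prod_range_le_avg_pow (a : ℕ → ℝ) (ha : ∀ i, 0 ≤ a i) {k : ℕ} (hk : 1 ≤ k) :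
    ∏ i ∈ range k, a i ≤ ((∑ i ∈ range k, a i) / k) ^ k := by
  have hk0 : (0 : ℝ) < k := by exact_mod_cast hk
  have h := Real.geom_mean_le_arith_mean_weighted (range k) (fun _ => (k : ℝ)⁻¹) a
    (fun _ _ => by positivity) (by simp [hk0.ne']) (fun i _ => ha i)
  rw [← Finset.mul_sum, ← div_eq_inv_mul] at h
  have h' := pow_le_pow_left₀ (Finset.prod_nonneg fun i _ => Real.rpow_nonneg (ha i) _) h k
  rw [← Finset.prod_pow] at h'
  refine le_trans (le_of_eq ?_) h'
  exact Finset.prod_congr rfl fun i _ => (Real.rpow_inv_natCast_pow (ha i) (by omega)).symm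

/-- Superlinear convergence of DFP in coordinates where the Hessian at the optimum is the
identity and the optimum is the origin. -/
theorem dfp_normalized {d : ℕ} {φ : E d → E d} {c ε δ r : ℝ} (hφ0 : φ 0 = 0)
    (hφ : ∀ τ u v, c * ‖u‖ ≤ τ → c * ‖v‖ ≤ τ → ‖φ u - φ v - (u - v)‖ ≤ τ * ‖u - v‖)
    (hc : 0 ≤ c) {u : ℕ → E d} {B : ℕ → Mat d}
    (hu : ∀ k, u (k + 1) = u k - mApp (B k)⁻¹ (φ (u k)))
    (hne : ∀ k, u (k + 1) - u k ≠ 0)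
    (hBup : ∀ k, B (k + 1) = dfpUpdate (B k) (u (k + 1) - u k) (φ (u (k + 1)) - φ (u k)))
    (hε : 0 < ε) (hδ : 0 < δ) (hr0 : 0 < r) (hr1 : r < 1)
    (hc1 : (4 * (2*δ + 1) / (1 - ε)^2 + (3 + ε) / (1 - ε)) * (ε / (1 - r)) ≤ δ)
    (hc2 : ε + 2*δ ≤ r / (1 + r)) (hu0 : c * ‖u 0‖ ≤ ε) (hB0 : frob (B 0 - 1) ≤ δ)
    {k : ℕ} (hk : 1 ≤ k) :
    ‖u k‖ ≤ ((2 * Real.sqrt 2 * δ * ((1 + r) / (1 - ε)) * Real.sqrt (k:ℝ)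
            + (1 + r) * ε / ((1 - r) * (1 - ε))) / (k:ℝ)) ^ k * ‖u 0‖ := by
  have hr : r / (1 + r) < 1 := by rw [div_lt_one (by linarith)]; linarith
  have hε1 : ε < 1 := by linarith
  have h2δ : 2 * δ < 1 := by linarith
  set W := 4 * (2*δ + 1) / (1 - ε)^2 + (3 + ε) / (1 - ε) with hW
  have hW0 : 0 ≤ W := by
    have : 0 < 1 - ε := by linarith
    positivity
  have hgeom : ∀ n, ∑ i ∈ range n, ε * r ^ i ≤ ε / (1 - r) := fun n => by
    rw [← Finset.mul_sum, geom_sum_eq hr1.ne, div_eq_mul_inv ε]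
    refine mul_le_mul_of_nonneg_left ?_ hε.le
    rw [← neg_div_neg_eq, neg_sub, neg_sub, ← one_div]
    have : 0 < 1 - r := by linarith
    gcongr
    linarith [pow_pos hr0 n]
  set ρ : ℕ → ℝ := fun i => ‖mApp (B i - 1) (u (i + 1) - u i)‖ / ‖u (i + 1) - u i‖ with hρ
  have hρ0 : ∀ i, 0 ≤ ρ i := fun i => by positivity
  have hlin : ∀ n, frob (B n - 1) ≤ 2 * δ → c * ‖u n‖ ≤ ε → ‖u (n + 1)‖ ≤ r * ‖u n‖ := by
    intro n hBn hun
    have hp : ‖φ (u n) - u n‖ ≤ ε * ‖u n‖ := by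
      simpa [hφ0] using hφ ε (u n) 0 hun (by simpa using hε.le)
    have h := norm_quasiNewton_step_le hBn h2δ hp
    rw [← hu] at h
    have h1 : (2 * δ + ε) ≤ r * (1 - 2 * δ) := by
      have : r / (1 + r) = r * (1 - r / (1 + r)) := by field_simp; ring
      nlinarith
    have h2 := h.trans (mul_le_mul_of_nonneg_right h1 (norm_nonneg (u n)))
    have h3 : 0 < 1 - 2 * δ := by linarith
    nlinarith
  have hinv : ∀ n, frob (B n - 1) ≤ δ + W * ∑ i ∈ range n, ε * r ^ i
      - (∑ i ∈ range n, ρ i ^ 2) / (2 * (2 * δ)) ∧ c * ‖u n‖ ≤ ε * r ^ n := by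
    intro n
    induction n with
    | zero => simpa using ⟨hB0, hu0⟩
    | succ n ih =>
      obtain ⟨ih1, ih2⟩ := ih
      have hBn : frob (B n - 1) ≤ 2 * δ := by
        have h1 := mul_le_mul_of_nonneg_left (hgeom n) hW0
        have h2 : 0 ≤ (∑ i ∈ range n, ρ i ^ 2) / (2 * (2 * δ)) := by positivity
        linarith
      have hrn : r ^ n ≤ 1 := pow_le_one₀ hr0.le hr1.le
      have hτε : ε * r ^ n ≤ ε := by nlinarith
      have hl := hlin n hBn (ih2.trans hτε)
      have hl' : c * ‖u (n + 1)‖ ≤ ε * r ^ (n + 1) := by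
        calc c * ‖u (n + 1)‖ ≤ c * (r * ‖u n‖) := by gcongr
          _ = r * (c * ‖u n‖) := by ring
          _ ≤ r * (ε * r ^ n) := by gcongr
          _ = _ := by ring
      refine ⟨?_, hl'⟩
      have hτ0 : 0 ≤ ε * r ^ n := by positivity
      have hl'' : c * ‖u (n + 1)‖ ≤ ε * r ^ n := hl'.trans (by
        rw [pow_succ]; nlinarith)
      have hstep := frob_dfpUpdate_sub_one_le (B n) (hne n)
        (hφ _ _ _ hl'' ih2) (hτε.trans_lt hε1) (by linarith : 0 < 2 * δ) hBn
      rw [← hBup] at hstep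
      have hWle : ε * r ^ n * (4 * (2 * δ + 1) / (1 - ε * r ^ n) ^ 2
          + (3 + ε * r ^ n) / (1 - ε * r ^ n)) ≤ W * (ε * r ^ n) := by
        rw [mul_comm W, hW]
        have : 0 < 1 - ε := by linarith
        gcongr
      rw [Finset.sum_range_succ, Finset.sum_range_succ, mul_add, add_div]
      linarith
  have hsum : ∑ i ∈ range k, ρ i ≤ 2 * Real.sqrt 2 * δ * Real.sqrt k := by
    have h1 : ∑ i ∈ range k, ρ i ^ 2 ≤ 8 * δ ^ 2 := by
      have h1 := mul_le_mul_of_nonneg_left (hgeom k) hW0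
      have h2 := (hinv k).1
      have h3 := frob_nonneg (B k - 1)
      have h4 : (∑ i ∈ range k, ρ i ^ 2) / (2 * (2 * δ)) ≤ 2 * δ := by linarith
      rw [div_le_iff₀ (by positivity)] at h4
      linarith
    refine abs_le_of_sq_le_sq' ?_ (by positivity) |>.2
    have h2 := sq_sum_le_card_mul_sum_sq (s := range k) (f := ρ)
    rw [card_range] at h2
    have h3 : (2 * Real.sqrt 2 * δ * Real.sqrt k) ^ 2 = k * (8 * δ ^ 2) := by
      rw [mul_pow, mul_pow, mul_pow, Real.sq_sqrt (by positivity), Real.sq_sqrt (by positivity)]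
      ring
    rw [h3]
    exact h2.trans (by gcongr)
  set b : ℝ := (1 + r) / (1 - ε) with hb
  have hb0 : 0 ≤ b := div_nonneg (by linarith) (by linarith)
  have hsuper : ∀ n, ‖u (n + 1)‖ ≤ b * (ρ n + ε * r ^ n) * ‖u n‖ := by
    intro n
    have hBn : frob (B n - 1) ≤ 2 * δ := by
      have h1 := mul_le_mul_of_nonneg_left (hgeom n) hW0
      have h2 : 0 ≤ (∑ i ∈ range n, ρ i ^ 2) / (2 * (2 * δ)) := by positivity
      linarith [(hinv n).1]
    have hle : ∀ m, ε * r ^ m ≤ ε := fun m => by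
      nlinarith [pow_le_one₀ (n := m) hr0.le hr1.le]
    have hl := hlin n hBn ((hinv n).2.trans (hle n))
    have hun := (hinv (n + 1)).2
    have hun' : c * ‖u (n + 1)‖ ≤ ε * r ^ n := by
      refine hun.trans ?_
      have : 0 ≤ ε * r ^ n := by positivity
      rw [pow_succ]; nlinarith
    set s := u (n + 1) - u n with hs
    have hs0 : 0 < ‖s‖ := norm_pos_iff.2 (hne n)
    have hBs : mApp (B n) s = - φ (u n) := by
      have : s = - mApp (B n)⁻¹ (φ (u n)) := by rw [hs, hu]; abel
      rw [this, ← neg_one_smul ℝ, mApp_smul,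
        mApp_mApp_inv (isUnit_det_of_frob_sub_one_lt (hBn.trans_lt h2δ)), neg_one_smul]
    have hφn : φ (u (n + 1)) = (φ (u (n + 1)) - φ (u n) - s) - mApp (B n - 1) s := by
      rw [mApp_sub_left, mApp_one, hBs]; abel
    have h1 : ‖φ (u (n + 1))‖ ≤ (ρ n + ε * r ^ n) * ‖s‖ := by
      have e1 := norm_sub_le (φ (u (n + 1)) - φ (u n) - s) (mApp (B n - 1) s)
      rw [← hφn] at e1
      have e2 := hφ _ _ _ hun' (hinv n).2
      have e3 : ‖mApp (B n - 1) s‖ = ρ n * ‖s‖ := by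
        simp only [hρ]; rw [div_mul_cancel₀ _ hs0.ne']
      rw [← hs] at e2
      linarith
    have h2 : (1 - ε) * ‖u (n + 1)‖ ≤ ‖φ (u (n + 1))‖ := by
      have e1 : ‖φ (u (n + 1)) - u (n + 1)‖ ≤ ε * ‖u (n + 1)‖ := by
        simpa [hφ0] using hφ ε (u (n + 1)) 0 (hun.trans (hle _)) (by simpa using hε.le)
      have e2 := norm_sub_norm_le (u (n + 1)) (φ (u (n + 1)))
      rw [norm_sub_rev] at e2
      linarith
    have h3 : ‖s‖ ≤ (1 + r) * ‖u n‖ := by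
      have := norm_sub_le (u (n + 1)) (u n)
      linarith
    have h4 : 0 ≤ ρ n + ε * r ^ n := add_nonneg (hρ0 n) (by positivity)
    have h5 : (1 - ε) * ‖u (n + 1)‖ ≤ (ρ n + ε * r ^ n) * ((1 + r) * ‖u n‖) :=
      h2.trans (h1.trans (by gcongr))
    have h6 : 0 < 1 - ε := by linarith
    rw [← le_div_iff₀' h6] at h5
    refine h5.trans (le_of_eq ?_)
    rw [hb]; ring
  have hprod : ∀ n, ‖u n‖ ≤ (∏ i ∈ range n, b * (ρ i + ε * r ^ i)) * ‖u 0‖ := by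
    intro n
    induction n with
    | zero => simp
    | succ n ih =>
      rw [Finset.prod_range_succ]
      have h4 : 0 ≤ b * (ρ n + ε * r ^ n) :=
        mul_nonneg hb0 (add_nonneg (hρ0 n) (by positivity))
      calc _ ≤ _ := hsuper n
        _ ≤ b * (ρ n + ε * r ^ n) * ((∏ i ∈ range n, b * (ρ i + ε * r ^ i)) * ‖u 0‖) := by
          gcongr
        _ = _ := by ring
  refine (hprod k).trans (mul_le_mul_of_nonneg_right ?_ (norm_nonneg _))
  have hai : ∀ i, 0 ≤ b * (ρ i + ε * r ^ i) := fun i =>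
    mul_nonneg hb0 (add_nonneg (hρ0 i) (by positivity))
  refine (prod_range_le_avg_pow _ hai hk).trans ?_
  refine pow_le_pow_left₀ (div_nonneg (Finset.sum_nonneg fun i _ => hai i) (by positivity)) ?_ k
  refine div_le_div_of_nonneg_right ?_ (by positivity)
  rw [← Finset.mul_sum, Finset.sum_add_distrib]
  calc b * (∑ i ∈ range k, ρ i + ∑ i ∈ range k, ε * r ^ i)
      ≤ b * (2 * Real.sqrt 2 * δ * Real.sqrt k + ε / (1 - r)) := by
        gcongr; exact hgeom k
    _ = _ := by rw [hb]; field_simp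

lemma norm_sq_mApp_of_transpose_eq {d : ℕ} {S : Mat d} (hSt : Sᵀ = S) (v : E d) :
    ‖mApp S v‖ ^ 2 = dot v (mApp (S * S) v) := by
  rw [mApp_mul, dot_mApp, hSt, dot_self]

lemma dfpUpdate_congr_symm {d : ℕ} {S : Mat d} (hSt : Sᵀ = S) (hSu : IsUnit S.det) (B : Mat d)
    (s y : E d) :
    dfpUpdate (S⁻¹ * B * S⁻¹) (mApp S s) (mApp S⁻¹ y) = S⁻¹ * dfpUpdate B s y * S⁻¹ := by
  have hSit : (S⁻¹)ᵀ = S⁻¹ := by rw [Matrix.transpose_nonsing_inv, hSt]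
  have hd : dot (mApp S⁻¹ y) (mApp S s) = dot y s := by
    rw [dot_mApp, hSt, mApp_mApp_inv hSu]
  have hd' : dot (mApp S s) (mApp S⁻¹ y) = dot s y := by
    rw [dot_comm, hd, dot_comm]
  have h1 : outer (mApp S⁻¹ y) (mApp S s) = S⁻¹ * outer y s * S := by
    rw [mul_outer, outer_mul, hSt]
  have h2 : outer (mApp S s) (mApp S⁻¹ y) = S * outer s y * S⁻¹ := by
    rw [mul_outer, outer_mul, hSit]
  have h3 : outer (mApp S⁻¹ y) (mApp S⁻¹ y) = S⁻¹ * outer y y * S⁻¹ := by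
    rw [mul_outer, outer_mul, hSit]
  have hSS : S * S⁻¹ = 1 := Matrix.mul_nonsing_inv _ hSu
  have hSS' : S⁻¹ * S = 1 := Matrix.nonsing_inv_mul _ hSu
  have hl : 1 - (dot y s)⁻¹ • (S⁻¹ * outer y s * S)
      = S⁻¹ * (1 - (dot y s)⁻¹ • outer y s) * S := by
    rw [mul_sub, sub_mul, mul_one, hSS', Matrix.mul_smul, Matrix.smul_mul]
  have hr : 1 - (dot s y)⁻¹ • (S * outer s y * S⁻¹)
      = S * (1 - (dot s y)⁻¹ • outer s y) * S⁻¹ := by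
    rw [mul_sub, sub_mul, mul_one, hSS, Matrix.mul_smul, Matrix.smul_mul]
  unfold dfpUpdate
  rw [hd, hd', h1, h2, h3, hl, hr]
  generalize 1 - (dot y s)⁻¹ • outer y s = Q
  generalize 1 - (dot s y)⁻¹ • outer s y = R
  rw [mul_add, add_mul, Matrix.mul_smul, Matrix.smul_mul]
  congr 1
  calc S⁻¹ * Q * S * (S⁻¹ * B * S⁻¹) * (S * R * S⁻¹)
      = S⁻¹ * Q * (S * S⁻¹) * B * (S⁻¹ * S) * R * S⁻¹ := by simp only [mul_assoc]
    _ = _ := by rw [hSS, hSS']; simp only [mul_assoc, mul_one]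

lemma spec_conj_le {d : ℕ} {T : Mat d} {m : ℝ} (hm : 0 < m) (hT : ∀ v, m * ‖mApp T v‖ ≤ ‖v‖)
    (A : Mat d) : spec (T * A * T) ≤ spec A / m ^ 2 := by
  have hA : 0 ≤ spec A := norm_nonneg _
  refine ContinuousLinearMap.opNorm_le_bound _ (by positivity) fun v => ?_
  change ‖mApp (T * A * T) v‖ ≤ _
  rw [mApp_mul, mApp_mul, div_mul_eq_mul_div, le_div_iff₀ (by positivity)]
  have h1 := hT (mApp A (mApp T v))
  have h2 := norm_mApp_le_spec A (mApp T v)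
  have h3 := hT v
  calc ‖mApp T (mApp A (mApp T v))‖ * m ^ 2 = m * (m * ‖mApp T (mApp A (mApp T v))‖) := by ring
    _ ≤ m * (spec A * ‖mApp T v‖) := 
        mul_le_mul_of_nonneg_left (h1.trans h2) hm.le
    _ = spec A * (m * ‖mApp T v‖) := by ring
    _ ≤ _ := by gcongr

/-- A map with derivative within `c * ‖u‖` of the identity at every `u` is close to the identity
on differences. -/
lemma norm_image_sub_sub_le {d : ℕ} {φ : E d → E d} {A : E d → Mat d} {c : ℝ} (hc : 0 < c)
    (hφ : ∀ u, HasFDerivAt φ (Matrix.toEuclideanCLM (𝕜 := ℝ) (A u)) u)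
    (hA : ∀ u, spec (A u - 1) ≤ c * ‖u‖) {τ : ℝ} {u v : E d} (hu : c * ‖u‖ ≤ τ)
    (hv : c * ‖v‖ ≤ τ) : ‖φ u - φ v - (u - v)‖ ≤ τ * ‖u - v‖ := by
  have hmem : ∀ w : E d, w ∈ Metric.closedBall (0 : E d) (τ / c) ↔ c * ‖w‖ ≤ τ := fun w => by
    rw [mem_closedBall_zero_iff, le_div_iff₀' hc]
  have h := (convex_closedBall (0 : E d) (τ / c)).norm_image_sub_le_of_norm_hasFDerivWithin_le'
    (f := φ) (φ := ContinuousLinearMap.id ℝ (E d)) (C := τ)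
    (fun w _ => (hφ w).hasFDerivWithinAt) (fun w hw => ?_) ((hmem v).2 hv) ((hmem u).2 hu)
  · simpa using h
  · refine le_trans (le_of_eq ?_) ((hA w).trans ((hmem w).1 hw))
    rw [spec, map_sub, map_one]
    rfl

theorem dfp_superlinear_convergence_hessian_init
    {d : ℕ}
    (f : E d → ℝ) (g : E d → E d) (Hess : E d → Mat d) (xs : E d)
    (μ L M : ℝ) (hμ : 0 < μ) (hμL : μ ≤ L) (hM : 0 < M)
    -- `g` is the gradient of `f`, and `Hess` its Hessian (so `f` is twice differentiable)
    (hg : ∀ x, HasGradientAt f (g x) x)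
    (hHd : ∀ x, HasFDerivAt g (Matrix.toEuclideanCLM (𝕜 := ℝ) (Hess x)) x)
    -- `xs` is the unique minimizer of `f`
    (hmin : ∀ x, f xs ≤ f x)
    (huniq : ∀ x, (∀ y, f x ≤ f y) → x = xs)
    -- Assumption 1: strong convexity and gradient Lipschitz continuity
    (hgl : ∀ x y, μ * ‖x - y‖ ≤ ‖g x - g y‖)
    (hgu : ∀ x y, ‖g x - g y‖ ≤ L * ‖x - y‖)
    (hHl : ∀ x v, μ * ‖v‖ ^ 2 ≤ dot v (mApp (Hess x) v))
    (hHu : ∀ x v, dot v (mApp (Hess x) v) ≤ L * ‖v‖ ^ 2)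
    -- Assumption 2: Hessian Lipschitz continuity toward the optimum
    (hLip : ∀ x, spec (Hess x - Hess xs) ≤ M * ‖x - xs‖)
    -- `sqH` is the positive definite square root `H_*^{1/2}` of `H_* = ∇²f(x_*)`
    (sqH : Mat d) (hsqH : sqH.PosDef) (hsqH2 : sqH * sqH = Hess xs)
    -- the DFP method
    (x : ℕ → E d) (B : ℕ → Mat d)
    (hB0pd : (B 0).PosDef)
    (hxup : ∀ k, x (k+1) = x k - mApp (B k)⁻¹ (g (x k)))
    (hsne : ∀ k, x (k+1) - x k ≠ 0)
    (hBup : ∀ k, B (k+1) = dfpUpdate (B k) (x (k+1) - x k) (g (x (k+1)) - g (x k)))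
    (ε δ r : ℝ) (hε : 0 < ε) (hδ : 0 < δ) (hr0 : 0 < r) (hr1 : r < 1)
    (hc1 : (4 * (2*δ + 1) / (1 - ε)^2 + (3 + ε) / (1 - ε)) * (ε / (1 - r)) ≤ δ)
    (hc2 : ε + 2*δ ≤ r / (1 + r))
    (hx0 : ‖x 0 - xs‖ ≤ min (μ ^ ((3:ℝ)/2) * ε / (M * Real.sqrt L)) (μ * δ / (M * Real.sqrt (d:ℝ))))
    (hB0 : B 0 = Hess (x 0)) :
    ∀ k : ℕ, 1 ≤ k →
      ‖x k - xs‖ ≤ Real.sqrt (L / μ) *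
        ((2 * Real.sqrt 2 * δ * ((1 + r) / (1 - ε)) * Real.sqrt (k:ℝ)
            + (1 + r) * ε / ((1 - r) * (1 - ε))) / (k:ℝ)) ^ k * ‖x 0 - xs‖ := by
  intro k hk
  have hL : 0 < L := hμ.trans_le hμL
  have hSt : sqHᵀ = sqH := by simpa using hsqH.isHermitian.eq
  have hSu : IsUnit sqH.det := hsqH.det_pos.ne'.isUnit
  have hSS : sqH * sqH⁻¹ = 1 := Matrix.mul_nonsing_inv _ hSu
  have hSS' : sqH⁻¹ * sqH = 1 := Matrix.nonsing_inv_mul _ hSu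
  have hSlow : ∀ v, Real.sqrt μ * ‖v‖ ≤ ‖mApp sqH v‖ := fun v => by
    rw [← sq_le_sq₀ (by positivity) (norm_nonneg _), mul_pow, Real.sq_sqrt hμ.le,
      norm_sq_mApp_of_transpose_eq hSt, hsqH2]
    exact hHl xs v
  have hSup : ∀ v, ‖mApp sqH v‖ ≤ Real.sqrt L * ‖v‖ := fun v => by
    rw [← sq_le_sq₀ (norm_nonneg _) (by positivity), mul_pow, Real.sq_sqrt hL.le,
      norm_sq_mApp_of_transpose_eq hSt, hsqH2]
    exact hHu xs v
  have hSinv : ∀ v, Real.sqrt μ * ‖mApp sqH⁻¹ v‖ ≤ ‖v‖ := fun v => by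
    simpa only [mApp_mApp_inv hSu] using hSlow (mApp sqH⁻¹ v)
  have hsμ : 0 < Real.sqrt μ := Real.sqrt_pos.2 hμ
  have hconj : ∀ z, sqH⁻¹ * Hess z * sqH⁻¹ - 1 = sqH⁻¹ * (Hess z - Hess xs) * sqH⁻¹ := fun z => by
    have : sqH⁻¹ * Hess xs * sqH⁻¹ = 1 := by
      rw [← hsqH2, ← mul_assoc, hSS', one_mul, hSS]
    rw [mul_sub, sub_mul, this]
  have hspec : ∀ z, spec (sqH⁻¹ * Hess z * sqH⁻¹ - 1) ≤ M * ‖z - xs‖ / μ := fun z => by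
    rw [hconj]
    refine (spec_conj_le hsμ hSinv _).trans ?_
    rw [Real.sq_sqrt hμ.le]
    exact div_le_div_of_nonneg_right (hLip z) hμ.le
  have hgxs : g xs = 0 := by
    have h := IsLocalMin.hasFDerivAt_eq_zero (Filter.Eventually.of_forall hmin)
      (hg xs).hasFDerivAt
    simpa using h
  have hrpow : μ ^ ((3:ℝ)/2) = μ * Real.sqrt μ := by
    rw [Real.sqrt_eq_rpow, ← Real.rpow_one_add' hμ.le (by norm_num)]; norm_num
  rw [hrpow] at hx0
  set c := M / (μ * Real.sqrt μ) with hc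
  have hc0 : 0 < c := by positivity
  set φ : E d → E d := fun w => mApp sqH⁻¹ (g (xs + mApp sqH⁻¹ w)) with hφ
  have hφd : ∀ w, HasFDerivAt φ (Matrix.toEuclideanCLM (𝕜 := ℝ)
      (sqH⁻¹ * Hess (xs + mApp sqH⁻¹ w) * sqH⁻¹)) w := fun w => by
    have h1 : HasFDerivAt (fun w => xs + mApp sqH⁻¹ w)
        (Matrix.toEuclideanCLM (𝕜 := ℝ) sqH⁻¹) w :=
      (ContinuousLinearMap.hasFDerivAt (Matrix.toEuclideanCLM (𝕜 := ℝ) sqH⁻¹)).const_add xs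
    have h2 := (ContinuousLinearMap.hasFDerivAt (Matrix.toEuclideanCLM (𝕜 := ℝ) sqH⁻¹)).comp w
      ((hHd (xs + mApp sqH⁻¹ w)).comp w h1)
    rw [map_mul, map_mul]
    exact h2
  have hφA : ∀ w, spec (sqH⁻¹ * Hess (xs + mApp sqH⁻¹ w) * sqH⁻¹ - 1) ≤ c * ‖w‖ := fun w => by
    refine (hspec _).trans ?_
    rw [add_sub_cancel_left, hc, div_mul_eq_mul_div, div_le_div_iff₀ hμ (by positivity)]
    nlinarith [mul_le_mul_of_nonneg_left (hSinv w) (mul_pos hM hμ).le]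
  have hux : ∀ n, xs + mApp sqH⁻¹ (mApp sqH (x n - xs)) = x n := fun n => by
    rw [mApp_inv_mApp hSu]; abel
  have hφu : ∀ n, φ (mApp sqH (x n - xs)) = mApp sqH⁻¹ (g (x n)) := fun n => by
    rw [hφ]; simp only [hux]
  have hstep : ∀ n, mApp sqH (x (n + 1) - xs) - mApp sqH (x n - xs)
      = mApp sqH (x (n + 1) - x n) := fun n => by
    rw [← mApp_sub]; congr 1; abel
  have hε1 : 0 < 1 - ε := by
    have : r / (1 + r) < 1 := by rw [div_lt_one (by linarith)]; linarith
    linarith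
  have hmain := dfp_normalized (φ := φ) (c := c) (ε := ε) (δ := δ) (r := r)
    (u := fun n => mApp sqH (x n - xs)) (B := fun n => sqH⁻¹ * B n * sqH⁻¹)
    (by simp [hφ, mApp, hgxs])
    (fun τ u v hu hv => norm_image_sub_sub_le hc0 hφd hφA hu hv) hc0.le
    (fun n => by
      have hinv : (sqH⁻¹ * B n * sqH⁻¹)⁻¹ = sqH * ((B n)⁻¹ * sqH) := by
        rw [Matrix.mul_inv_rev, Matrix.mul_inv_rev, Matrix.nonsing_inv_nonsing_inv _ hSu]
      rw [hφu, hinv, mApp_mul, mApp_mul, mApp_mApp_inv hSu, ← mApp_sub, hxup]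
      congr 1; abel)
    (fun n h => by
      rw [hstep] at h
      apply hsne n
      rw [← mApp_inv_mApp hSu (x (n + 1) - x n), h]
      simp [mApp])
    (fun n => by
      rw [hφu, hφu, hstep, ← mApp_sub, hBup, dfpUpdate_congr_symm hSt hSu])
    hε hδ hr0 hr1 hc1 hc2
    (by
      have h1 := hx0.trans (min_le_left _ _)
      have hsL : 0 < Real.sqrt L := Real.sqrt_pos.2 hL
      rw [le_div_iff₀ (by positivity)] at h1
      rw [hc, div_mul_eq_mul_div, div_le_iff₀ (by positivity)]
      nlinarith [mul_le_mul_of_nonneg_left (hSup (x 0 - xs)) hM.le])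
    (by
      have h1 := hx0.trans (min_le_right _ _)
      refine (frob_le_sqrt_mul_spec _).trans ?_
      rw [hB0]
      refine (mul_le_mul_of_nonneg_left (hspec (x 0)) (Real.sqrt_nonneg _)).trans ?_
      have hd : 0 < d := by
        rcases Nat.eq_zero_or_pos d with rfl | h
        · exact absurd (Subsingleton.elim _ _) (hsne 0)
        · exact h
      have hsd : 0 < Real.sqrt (d : ℝ) := Real.sqrt_pos.2 (by exact_mod_cast hd)
      rw [le_div_iff₀ (by positivity)] at h1
      rw [← mul_div_assoc, div_le_iff₀ hμ]
      linarith)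
    hk
  have hρ : 0 ≤ (2 * Real.sqrt 2 * δ * ((1 + r) / (1 - ε)) * Real.sqrt (k:ℝ)
      + (1 + r) * ε / ((1 - r) * (1 - ε))) / (k:ℝ) := by
    have : 0 < 1 - r := by linarith
    positivity
  have hfin := (hSlow (x k - xs)).trans
    (hmain.trans (mul_le_mul_of_nonneg_left (hSup (x 0 - xs)) (pow_nonneg hρ k)))
  rw [← le_div_iff₀' hsμ] at hfin
  refine hfin.trans (le_of_eq ?_)
  rw [Real.sqrt_div hL.le]
  ring
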